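/- (Proposition F.1) Let G be an IMM_sc-consistent execution graph and ⟨C, I⟩ a partial traversal configuration of G such that C ≠ E. Then there exist C' and I' such that G ⊢ ⟨C, I⟩ →_STC ⟨C', I'⟩, i.e., a small traversal step is always possible from a non-final partial traversal configuration. -/

import Mathlib

/-! ## Basic definitions: events, labels, relations -/

abbrev Loc := ℕ
abbrev Val := ℕ

inductive Mode
  | rlx | acq | rel | acqrel | sc
deriving DecidableEq

inductive ExFlag
  | notex | ex
deriving DecidableEq

inductive Strength
  | normal | strong
deriving DecidableEq

inductive Label
  | read (o : Mode) (x : Loc) (v : Val) (s : ExFlag)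
  | write (o : Mode) (x : Loc) (v : Val) (st : Strength)
  | fence (o : Mode)
deriving DecidableEq

inductive Event
  | init (x : Loc)
  | ev (tid : ℕ) (sn : ℚ)
deriving DecidableEq

def Event.isInit : Event → Prop
  | .init _ => True
  | .ev _ _ => False

/-- the set of initialization events -/
def InitE : Set Event := {e | e.isInit}

/-- the `sequenced-before` partial order on events: initialization events precede all
non-initialization events, and events of the same thread are ordered by serial number -/
def evLt : Event → Event → Prop
  | .init _, .ev _ _ => True
  | .ev i n, .ev j m => i = j ∧ n < m
  | _, _ => False

abbrev REv := Event → Event → Prop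

/-- relational composition `r ; s` -/
def seqR (r s : REv) : REv := fun a c => ∃ b, r a b ∧ s b c

infixr:70 " ⬝ " => seqR

/-- identity relation on a set: `[A]` -/
def eqv (A : Set Event) : REv := fun a b => a = b ∧ a ∈ A

notation:max "⦗" A "⦘" => eqv A

/-- union of relations -/
def runion (r s : REv) : REv := fun a b => r a b ∨ s a b

infixl:65 " ∪ᵣ " => runion

/-- reflexive closure `r^?` -/
def rcl (r : REv) : REv := fun a b => a = b ∨ r a b

/-- transitive closure `r⁺` -/
def tcl (r : REv) : REv := Relation.TransGen r

/-- reflexive-transitive closure `r*` -/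
def rtcl (r : REv) : REv := Relation.ReflTransGen r

/-- inverse relation `r⁻¹` -/
def transp (r : REv) : REv := fun a b => r b a

def rdom (r : REv) : Set Event := {a | ∃ b, r a b}

def rcodom (r : REv) : Set Event := {b | ∃ a, r a b}

/-- immediate edges: `imm(r) = r ∖ r;r` -/
def immediate (r : REv) : REv := fun a b => r a b ∧ ¬ (r ⬝ r) a b

def acyclic (r : REv) : Prop := Irreflexive (tcl r)

/-- `r` totally orders `A` -/
def totalOn (A : Set Event) (r : REv) : Prop :=
  ∀ a ∈ A, ∀ b ∈ A, a ≠ b → r a b ∨ r b a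

def Label.locOf : Label → Option Loc
  | .read _ x _ _ => some x
  | .write _ x _ _ => some x
  | .fence _ => none

def Label.valOf : Label → Option Val
  | .read _ _ v _ => some v
  | .write _ _ v _ => some v
  | .fence _ => none

/-! ## IMM execution graphs -/

structure Execution where
  E : Set Event
  lab : Event → Label
  rmw : REv
  data : REv
  addr : REv
  ctrl : REv
  casdep : REv
  rf : REv
  co : REv

namespace Execution

variable (G : Execution)

def loc (e : Event) : Option Loc := (G.lab e).locOf
def valu (e : Event) : Option Val := (G.lab e).valOf

/-- read events -/
def R : Set Event := {e | e ∈ G.E ∧ ∃ o x v s, G.lab e = .read o x v s}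
/-- write events -/
def W : Set Event := {e | e ∈ G.E ∧ ∃ o x v st, G.lab e = .write o x v st}
/-- fence events -/
def F : Set Event := {e | e ∈ G.E ∧ ∃ o, G.lab e = .fence o}
/-- acquire reads -/
def Racq : Set Event := {e | e ∈ G.E ∧ ∃ x v s, G.lab e = .read .acq x v s}
/-- exclusive reads -/
def Rex : Set Event := {e | e ∈ G.E ∧ ∃ o x v, G.lab e = .read o x v .ex}
/-- release writes -/
def Wrel : Set Event := {e | e ∈ G.E ∧ ∃ x v st, G.lab e = .write .rel x v st}
/-- strong writes -/
def Wstrong : Set Event := {e | e ∈ G.E ∧ ∃ o x v, G.lab e = .write o x v .strong}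
/-- writes to location `x` -/
def Wloc (x : Loc) : Set Event := {e | e ∈ G.W ∧ G.loc e = some x}
/-- reads from location `x` -/
def Rloc (x : Loc) : Set Event := {e | e ∈ G.R ∧ G.loc e = some x}
/-- SC fences -/
def Fsc : Set Event := {e | e ∈ G.E ∧ G.lab e = .fence .sc}
/-- fences of mode exactly `rel` -/
def Frel : Set Event := {e | e ∈ G.E ∧ G.lab e = .fence .rel}
/-- fences whose mode is at least `rel` (i.e. `rel`, `acqrel` or `sc`) -/
def FgeRel : Set Event :=
  {e | e ∈ G.E ∧ (G.lab e = .fence .rel ∨ G.lab e = .fence .acqrel ∨ G.lab e = .fence .sc)}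
/-- fences whose mode is at least `acq` (i.e. `acq`, `acqrel` or `sc`) -/
def FgeAcq : Set Event :=
  {e | e ∈ G.E ∧ (G.lab e = .fence .acq ∨ G.lab e = .fence .acqrel ∨ G.lab e = .fence .sc)}

/-- program order -/
def po : REv := fun a b => a ∈ G.E ∧ b ∈ G.E ∧ evLt a b

/-- both events access the same location -/
def sameLoc : REv := fun a b => ∃ x, G.loc a = some x ∧ G.loc b = some x

/-- `po|loc` -/
def poloc : REv := fun a b => G.po a b ∧ G.sameLoc a b

def rfi : REv := fun a b => G.rf a b ∧ G.po a b
def rfe : REv := fun a b => G.rf a b ∧ ¬ G.po a b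
def coi : REv := fun a b => G.co a b ∧ G.po a b
def coe : REv := fun a b => G.co a b ∧ ¬ G.po a b

/-- from-read -/
def fr : REv := transp G.rf ⬝ G.co
def fri : REv := fun a b => G.fr a b ∧ G.po a b
def fre : REv := fun a b => G.fr a b ∧ ¬ G.po a b

/-- release sequence -/
def rs : REv :=
  ⦗G.W⦘ ⬝ G.poloc ⬝ ⦗G.W⦘ ∪ᵣ ⦗G.W⦘ ⬝ rtcl (rcl G.poloc ⬝ G.rf ⬝ G.rmw)

/-- release prefix -/
def release : REv := (⦗G.Wrel⦘ ∪ᵣ ⦗G.FgeRel⦘ ⬝ G.po) ⬝ G.rs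

/-- synchronizes with -/
def sw : REv :=
  G.release ⬝ (G.rfi ∪ᵣ rcl G.poloc ⬝ G.rfe) ⬝ (⦗G.Racq⦘ ∪ᵣ G.po ⬝ ⦗G.FgeAcq⦘)

/-- happens-before -/
def hb : REv := tcl (G.po ∪ᵣ G.sw)

/-- extended coherence order -/
def eco : REv := G.rf ∪ᵣ G.co ⬝ rcl G.rf ∪ᵣ G.fr ⬝ rcl G.rf

/-- barrier order -/
def bob : REv :=
  G.po ⬝ ⦗G.Wrel⦘ ∪ᵣ ⦗G.Racq⦘ ⬝ G.po ∪ᵣ G.po ⬝ ⦗G.F⦘ ∪ᵣ ⦗G.F⦘ ⬝ G.po ∪ᵣ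
    ⦗G.Wrel⦘ ⬝ G.poloc ⬝ ⦗G.W⦘

/-- syntactic dependencies -/
def deps : REv :=
  G.data ∪ᵣ G.ctrl ∪ᵣ G.addr ⬝ rcl G.po ∪ᵣ G.casdep ∪ᵣ ⦗G.Rex⦘ ⬝ G.po

/-- preserved program order -/
def ppo : REv := ⦗G.R⦘ ⬝ tcl (G.deps ∪ᵣ G.rfi) ⬝ ⦗G.W⦘

def detour : REv := fun a b => (G.coe ⬝ G.rfe) a b ∧ G.po a b

/-- partial SC fence order -/
def psc : REv := ⦗G.Fsc⦘ ⬝ G.hb ⬝ G.eco ⬝ G.hb ⬝ ⦗G.Fsc⦘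

/-- the acyclicity relation of IMM -/
def ar : REv :=
  G.rfe ∪ᵣ G.bob ∪ᵣ G.ppo ∪ᵣ G.detour ∪ᵣ G.psc ∪ᵣ ⦗G.Wstrong⦘ ⬝ G.po ⬝ ⦗G.W⦘

/-! RC11-style variants -/

def rsRC11 : REv := ⦗G.W⦘ ⬝ rcl G.poloc ⬝ rtcl (G.rf ⬝ G.rmw)

def releaseRC11 : REv := (⦗G.Wrel⦘ ∪ᵣ ⦗G.FgeRel⦘ ⬝ G.po) ⬝ G.rsRC11

def swRC11 : REv := G.releaseRC11 ⬝ G.rf ⬝ (⦗G.Racq⦘ ∪ᵣ G.po ⬝ ⦗G.FgeAcq⦘)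

def hbRC11 : REv := tcl (G.po ∪ᵣ G.swRC11)

end Execution

/-- Well-formedness of an IMM execution graph -/
structure ExecWf (G : Execution) : Prop where
  finE : G.E.Finite
  init_lab : ∀ x, Event.init x ∈ G.E →
    G.lab (Event.init x) = Label.write .rlx x 0 .normal
  read_mode : ∀ e ∈ G.E, ∀ o x v s, G.lab e = .read o x v s → o = Mode.rlx ∨ o = Mode.acq
  write_mode : ∀ e ∈ G.E, ∀ o x v st, G.lab e = .write o x v st → o = Mode.rlx ∨ o = Mode.rel
  fence_mode : ∀ e ∈ G.E, ∀ o, G.lab e = .fence o →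
    o = Mode.acq ∨ o = Mode.rel ∨ o = Mode.acqrel ∨ o = Mode.sc
  rmw_sub : ∀ a b, G.rmw a b → a ∈ G.Rex ∧ b ∈ G.W ∧ G.sameLoc a b ∧ immediate G.po a b
  strong_rmw : G.Wstrong ⊆ rcodom G.rmw
  data_sub : ∀ a b, G.data a b → a ∈ G.R ∧ G.po a b ∧ b ∈ G.W
  addr_sub : ∀ a b, G.addr a b → a ∈ G.R ∧ G.po a b ∧ (b ∈ G.R ∨ b ∈ G.W)
  ctrl_sub : ∀ a b, G.ctrl a b → a ∈ G.R ∧ G.po a b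
  ctrl_po : ∀ a b c, G.ctrl a b → G.po b c → G.ctrl a c
  casdep_sub : ∀ a b, G.casdep a b → a ∈ G.R ∧ G.po a b ∧ b ∈ G.Rex
  rf_sub : ∀ a b, G.rf a b → a ∈ G.W ∧ b ∈ G.R ∧ G.sameLoc a b
  rf_val : ∀ a b, G.rf a b → G.valu a = G.valu b
  rf_func : ∀ a b c, G.rf a c → G.rf b c → a = b
  co_sub : ∀ a b, G.co a b → a ∈ G.W ∧ b ∈ G.W ∧ G.sameLoc a b
  co_trans : Transitive G.co
  co_irr : Irreflexive G.co

/-- IMM-consistency (Definition 3.1) -/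
def IMMConsistent (G : Execution) : Prop :=
  rcodom G.rf = G.R ∧
  (∀ x, totalOn (G.Wloc x) G.co) ∧
  Irreflexive (G.hb ⬝ rcl G.eco) ∧
  (∀ a b, G.rmw a b → ¬ (G.fre ⬝ G.coe) a b) ∧
  acyclic G.ar

/-! ## IMM with a total order on SC fences (IMM_sc) -/

/-- `sc` is a strict total order on the SC fences of `G` -/
def scWf (G : Execution) (sc : REv) : Prop :=
  (∀ a b, sc a b → a ∈ G.Fsc ∧ b ∈ G.Fsc) ∧
  Transitive sc ∧ Irreflexive sc ∧ totalOn G.Fsc sc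

/-- `ar_sc`: the acyclicity relation of IMM with `psc` replaced by `sc` -/
def arSC (G : Execution) (sc : REv) : REv :=
  G.rfe ∪ᵣ G.bob ∪ᵣ G.ppo ∪ᵣ G.detour ∪ᵣ sc ∪ᵣ ⦗G.Wstrong⦘ ⬝ G.po ⬝ ⦗G.W⦘

/-- IMM_sc-consistency (the variant using `hb_RC11`). -/
def IMMscConsistent (G : Execution) (sc : REv) : Prop :=
  rcodom G.rf = G.R ∧
  (∀ x, totalOn (G.Wloc x) G.co) ∧
  Irreflexive (G.hbRC11 ⬝ rcl G.eco) ∧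
  (∀ a b, G.rmw a b → ¬ (G.fre ⬝ G.coe) a b) ∧
  acyclic (arSC G sc) ∧
  Irreflexive (sc ⬝ G.hbRC11 ⬝ rcl (G.eco ⬝ G.hbRC11))

/-! ## Full traversal -/

/-- Issuable events (full model). -/
def FIssuable (G : Execution) (C I : Set Event) : Set Event :=
  {w | w ∈ G.W ∧
    (∀ a, (⦗G.Wrel⦘ ⬝ G.poloc ∪ᵣ ⦗G.F⦘ ⬝ G.po) a w → a ∈ C) ∧
    (∀ a, ((G.detour ∪ᵣ G.rfe) ⬝ G.ppo) a w → a ∈ I) ∧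
    (∀ a, ((G.detour ∪ᵣ G.rfe) ⬝ ⦗G.Racq⦘ ⬝ G.po) a w → a ∈ I) ∧
    (∀ a, (⦗G.Wstrong⦘ ⬝ G.po) a w → a ∈ I)}

/-- Coverable events (full model). -/
def FCoverable (G : Execution) (sc : REv) (C I : Set Event) : Set Event :=
  {e | e ∈ G.E ∧ (∀ a, G.po a e → a ∈ C) ∧
    ((e ∈ G.W ∧ e ∈ I) ∨
     (e ∈ G.R ∧ ∀ a, G.rf a e → a ∈ I) ∨
     (e ∈ G.F ∧ e ∉ G.Fsc) ∨
     (e ∈ G.Fsc ∧ ∀ a, sc a e → a ∈ C))}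

/-- `⟨C, I⟩` is a traversal configuration of `G`. -/
def TravConfig (G : Execution) (sc : REv) (C I : Set Event) : Prop :=
  G.E ∩ InitE ⊆ C ∧
  C ⊆ FCoverable G sc C I ∧
  I ⊆ FIssuable G C I ∧
  C ∩ G.W ⊆ I ∧
  I ∩ G.Wrel ⊆ C ∧
  rcodom (⦗C⦘ ⬝ G.rmw) ⊆ C

/-- The (full) traversal steps of Figure 8. -/
inductive TravStep (G : Execution) (sc : REv) :
    Set Event × Set Event → Set Event × Set Event → Prop
  | issue {C I : Set Event} {w : Event} :
      w ∈ FIssuable G C I → w ∉ G.Wrel → w ∉ I →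
      TravStep G sc (C, I) (C, insert w I)
  | cover {C I : Set Event} {e : Event} :
      e ∈ FCoverable G sc C I → (∀ b, ¬ G.rmw e b) → e ∉ C →
      TravStep G sc (C, I) (insert e C, I)
  | releaseCover {C I : Set Event} {w : Event} :
      w ∈ G.Wrel → (∀ a, G.po a w → a ∈ C) → w ∉ C → w ∉ I →
      TravStep G sc (C, I) (insert w C, insert w I)
  | rmwCover {C I I' : Set Event} {r w : Event} :
      r ∈ FCoverable G sc C I → G.rmw r w → r ∉ C → w ∉ C →
      ((w ∈ I ∧ I' = I) ∨ (w ∈ G.Wrel ∧ w ∉ I ∧ I' = insert w I)) →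
      TravStep G sc (C, I) (insert r (insert w C), I')

/-- Small traversal steps. -/
inductive STCStep (G : Execution) (sc : REv) :
    Set Event × Set Event → Set Event × Set Event → Prop
  | cover {C I : Set Event} {a : Event} :
      a ∈ FCoverable G sc C I → a ∉ C → STCStep G sc (C, I) (insert a C, I)
  | issue {C I : Set Event} {w : Event} :
      w ∈ FIssuable G C I → w ∉ I → STCStep G sc (C, I) (C, insert w I)

/-- `⟨C, I⟩` is a partial traversal configuration of `G`. -/
def PartialTravConfig (G : Execution) (sc : REv) (C I : Set Event) : Prop :=
  G.E ∩ InitE ⊆ C ∧ C ⊆ FCoverable G sc C I ∧ I ⊆ FIssuable G C I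

/-- A nonempty finite set has a minimal element for the transitive closure of an acyclic
relation. -/
theorem exists_tcl_minimal {r : REv} (hr : acyclic r) {S : Set Event} (hfin : S.Finite)
    (hS : S.Nonempty) : ∃ m ∈ S, ∀ a ∈ S, ¬ tcl r a m := by
  have : IsStrictOrder Event (tcl r) :=
    { irrefl := hr, trans := fun _ _ _ => Relation.TransGen.trans }
  obtain ⟨m, hm, hmin⟩ := (hfin.wellFoundedOn (r := tcl r)).has_min Set.univ
    (by obtain ⟨x, hx⟩ := hS; exact ⟨⟨x, hx⟩, trivial⟩)
  exact ⟨m, m.2, fun a ha => hmin ⟨a, ha⟩ trivial⟩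

theorem evLt_trans {a b c : Event} (hab : evLt a b) (hbc : evLt b c) : evLt a c := by
  cases a <;> cases b <;> cases c <;> simp only [evLt] at hab hbc ⊢
  exact ⟨hab.1.trans hbc.1, hab.2.trans hbc.2⟩

theorem evLt_irrefl (a : Event) : ¬ evLt a a := by
  cases a <;> simp [evLt]

namespace Execution

variable {G : Execution}

theorem po_trans {a b c : Event} (hab : G.po a b) (hbc : G.po b c) : G.po a c :=
  ⟨hab.1, hbc.2.1, evLt_trans hab.2.2 hbc.2.2⟩

theorem tcl_po {a b : Event} (h : tcl G.po a b) : G.po a b := by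
  induction h with
  | single h => exact h
  | tail _ h ih => exact po_trans ih h

theorem acyclic_po : acyclic G.po := fun a h => evLt_irrefl a (tcl_po h).2.2

theorem mem_R_or_W_or_F {e : Event} (he : e ∈ G.E) : e ∈ G.R ∨ e ∈ G.W ∨ e ∈ G.F := by
  cases h : G.lab e with
  | read o x v s => exact .inl ⟨he, o, x, v, s, h⟩
  | write o x v st => exact .inr (.inl ⟨he, o, x, v, st, h⟩)
  | fence o => exact .inr (.inr ⟨he, o, h⟩)

/-- Every uncovered event has a `po`-earliest uncovered event before or equal to it. -/
theorem exists_first_uncovered (hfin : G.E.Finite) {C : Set Event} {e : Event}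
    (he : e ∈ G.E) (heC : e ∉ C) :
    ∃ n ∈ G.E, n ∉ C ∧ rcl G.po n e ∧ ∀ a, G.po a n → a ∈ C := by
  obtain ⟨n, ⟨hn, hnC, hne⟩, hmin⟩ :=
    exists_tcl_minimal (acyclic_po (G := G)) (S := {n | n ∈ G.E ∧ n ∉ C ∧ rcl G.po n e})
      (hfin.subset fun _ h => h.1) ⟨e, he, heC, .inl rfl⟩
  refine ⟨n, hn, hnC, hne, fun a ha => by_contra fun haC => ?_⟩
  refine hmin a ⟨ha.1, haC, .inr ?_⟩ (.single ha)
  rcases hne with rfl | hne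
  · exact ha
  · exact po_trans ha hne

/-- If all coverable events are covered, then an uncovered event is preceded by a
`po`-earliest uncovered event which is an unissued write, a read from an unissued write,
or an SC fence with an uncovered `sc`-predecessor. -/
theorem exists_blocked (hfin : G.E.Finite) {sc : REv} {C I : Set Event}
    (hcov : FCoverable G sc C I ⊆ C) {e : Event} (he : e ∈ G.E) (heC : e ∉ C) :
    ∃ n, n ∉ C ∧ rcl G.po n e ∧
      ((n ∈ G.W ∧ n ∉ I) ∨ (n ∈ G.R ∧ ∃ a, G.rf a n ∧ a ∉ I) ∨
        (n ∈ G.Fsc ∧ ∃ a, sc a n ∧ a ∉ C)) := by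
  obtain ⟨n, hn, hnC, hne, hpre⟩ := exists_first_uncovered hfin he heC
  refine ⟨n, hnC, hne, ?_⟩
  by_contra! hcon
  obtain ⟨hw, hr, hf⟩ := hcon
  refine hnC (hcov ⟨hn, hpre, ?_⟩)
  rcases mem_R_or_W_or_F hn with h | h | h
  · exact .inr (.inl ⟨h, hr h⟩)
  · exact .inl ⟨h, hw h⟩
  · by_cases hs : n ∈ G.Fsc
    · exact .inr (.inr (.inr ⟨hs, hf hs⟩))
    · exact .inr (.inr (.inl ⟨h, hs⟩))

theorem Fsc_subset_F : G.Fsc ⊆ G.F := fun _ h => ⟨h.1, .sc, h.2⟩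

theorem notMem_W_of_mem_F {e : Event} (he : e ∈ G.F) : e ∉ G.W := by
  rintro ⟨-, o, x, v, st, hw⟩
  obtain ⟨-, o', hf⟩ := he
  simp [hf] at hw

end Execution

section arSC

variable {G : Execution} {sc : REv} {a b : Event}

theorem arSC_of_rfe (h : G.rfe a b) : arSC G sc a b := by
  simp only [arSC, runion]; tauto

theorem arSC_of_bob (h : G.bob a b) : arSC G sc a b := by
  simp only [arSC, runion]; tauto

theorem arSC_of_ppo (h : G.ppo a b) : arSC G sc a b := by
  simp only [arSC, runion]; tauto

theorem arSC_of_detour (h : G.detour a b) : arSC G sc a b := by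
  simp only [arSC, runion]; tauto

theorem arSC_of_sc (h : sc a b) : arSC G sc a b := by
  simp only [arSC, runion]; tauto

theorem arSC_of_Wstrong_po (ha : a ∈ G.Wstrong) (h : G.po a b) (hb : b ∈ G.W) :
    arSC G sc a b :=
  .inr ⟨a, ⟨rfl, ha⟩, b, h, rfl, hb⟩

theorem bob_of_po_Wrel_or_F (h : G.po a b) (hb : b ∈ G.Wrel ∪ G.F) : G.bob a b := by
  rcases hb with hb | hb
  · exact .inl (.inl (.inl (.inl ⟨b, h, rfl, hb⟩)))
  · exact .inl (.inl (.inr ⟨b, h, rfl, hb⟩))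

theorem bob_of_Racq_po (ha : a ∈ G.Racq) (h : G.po a b) : G.bob a b :=
  .inl (.inl (.inl (.inr ⟨a, ⟨rfl, ha⟩, h⟩)))

theorem bob_of_F_po (ha : a ∈ G.F) (h : G.po a b) : G.bob a b :=
  .inl (.inr ⟨a, ⟨rfl, ha⟩, h⟩)

theorem bob_of_Wrel_poloc (ha : a ∈ G.Wrel) (h : G.poloc a b) (hb : b ∈ G.W) : G.bob a b :=
  .inr ⟨a, ⟨rfl, ha⟩, b, h, rfl, hb⟩

end arSC

namespace Execution

/-- The events whose issuing (for writes) or covering (for fences) is still pending. -/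
def pending (G : Execution) (C I : Set Event) : Set Event := (G.W \ I) ∪ (G.F \ C)

variable {G : Execution} {sc : REv} {C I : Set Event}

/-- If all coverable events are covered, every uncovered release write or fence has a pending
`arSC`-predecessor, unless it is itself a pending write. -/
theorem exists_pending_of_uncovered (hwf : ExecWf G) (hsc : scWf G sc)
    (hcov : FCoverable G sc C I ⊆ C) {e : Event} (he : e ∈ G.Wrel ∪ G.F) (heC : e ∉ C) :
    ∃ a ∈ G.pending C I, (a = e ∧ e ∈ G.W) ∨ tcl (arSC G sc) a e := by
  have heE : e ∈ G.E := by rcases he with h | h <;> exact h.1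
  have har : ∀ {a}, G.po a e → arSC G sc a e :=
    fun h => arSC_of_bob (bob_of_po_Wrel_or_F h he)
  have hcomp : ∀ {a n}, arSC G sc a n → rcl G.po n e → tcl (arSC G sc) a e := by
    rintro a n h (rfl | hne)
    · exact .single h
    · exact .head h (.single (har hne))
  obtain ⟨n, hnC, hne, hn | ⟨hnR, a, ha, haI⟩ | ⟨hn, a, ha, haC⟩⟩ :=
    exists_blocked hwf.finE hcov heE heC
  · refine ⟨n, .inl hn, ?_⟩
    rcases hne with rfl | hne
    · exact .inl ⟨rfl, hn.1⟩
    · exact .inr (.single (har hne))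
  · refine ⟨a, .inl ⟨(hwf.rf_sub a n ha).1, haI⟩, .inr ?_⟩
    by_cases hpo : G.po a n
    · rcases hne with rfl | hne
      · exact .single (har hpo)
      · exact .single (har (po_trans hpo hne))
    · exact hcomp (arSC_of_rfe ⟨ha, hpo⟩) hne
  · exact ⟨a, .inr ⟨Fsc_subset_F (hsc.1 a n ha).1, haC⟩, .inr (hcomp (arSC_of_sc ha) hne)⟩

theorem detour_or_rfe_left_mem_W (hwf : ExecWf G) {a b : Event}
    (h : (G.detour ∪ᵣ G.rfe) a b) : a ∈ G.W := by
  rcases h with ⟨⟨c, hc, -⟩, -⟩ | h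
  · exact (hwf.co_sub _ _ hc.1).1
  · exact (hwf.rf_sub _ _ h.1).1

theorem arSC_of_detour_or_rfe {a b : Event} (h : (G.detour ∪ᵣ G.rfe) a b) :
    arSC G sc a b :=
  h.elim arSC_of_detour arSC_of_rfe

/-- A write without pending `arSC`-predecessors is issuable, provided that all coverable
events are covered. -/
theorem issuable_of_no_pending (hwf : ExecWf G) (hsc : scWf G sc)
    (hcov : FCoverable G sc C I ⊆ C) {w : Event} (hw : w ∈ G.W)
    (hmin : ∀ a ∈ G.pending C I, ¬ tcl (arSC G sc) a w) : w ∈ FIssuable G C I := by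
  have hI : ∀ {a}, a ∈ G.W → tcl (arSC G sc) a w → a ∈ I :=
    fun haW h => by_contra fun haI => hmin _ (.inl ⟨haW, haI⟩) h
  refine ⟨hw, ?_, ?_, ?_, ?_⟩
  · intro a h
    have hbar : a ∈ G.Wrel ∪ G.F ∧ G.bob a w := by
      rcases h with ⟨_, ⟨rfl, ha⟩, h⟩ | ⟨_, ⟨rfl, ha⟩, h⟩
      · exact ⟨.inl ha, bob_of_Wrel_poloc ha h hw⟩
      · exact ⟨.inr ha, bob_of_F_po ha h⟩
    by_contra haC
    obtain ⟨b, hb, hba⟩ := exists_pending_of_uncovered hwf hsc hcov hbar.1 haC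
    rcases hba with ⟨rfl, -⟩ | hba
    · exact hmin b hb (.single (arSC_of_bob hbar.2))
    · exact hmin b hb (.tail hba (arSC_of_bob hbar.2))
  · rintro a ⟨r, har, hrw⟩
    exact hI (detour_or_rfe_left_mem_W hwf har)
      (.head (arSC_of_detour_or_rfe har) (.single (arSC_of_ppo hrw)))
  · rintro a ⟨r, har, _, ⟨rfl, hr⟩, hrw⟩
    exact hI (detour_or_rfe_left_mem_W hwf har)
      (.head (arSC_of_detour_or_rfe har) (.single (arSC_of_bob (bob_of_Racq_po hr hrw))))
  · rintro a ⟨_, ⟨rfl, ha⟩, haw⟩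
    have haW : a ∈ G.W := by
      obtain ⟨haE, o, x, v, hl⟩ := ha
      exact ⟨haE, o, x, v, .strong, hl⟩
    exact hI haW (.single (arSC_of_Wstrong_po ha haw hw))

end Execution

/-- Proposition F.1: from a non-final partial traversal configuration
of an IMM_sc-consistent execution graph, a small traversal step is always possible. -/
theorem small_traversal_step_exists (G : Execution) (sc : REv)
    (hwf : ExecWf G) (hsc : scWf G sc) (hcons : IMMscConsistent G sc)
    (C I : Set Event) (htc : PartialTravConfig G sc C I) (hne : C ≠ G.E) :
    ∃ C' I', STCStep G sc (C, I) (C', I') := by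
  by_contra hstep
  have hcov : FCoverable G sc C I ⊆ C :=
    fun a ha => by_contra fun haC => hstep ⟨_, _, .cover ha haC⟩
  have hiss : FIssuable G C I ⊆ I :=
    fun w hw => by_contra fun hwI => hstep ⟨_, _, .issue hw hwI⟩
  have hpend : (G.pending C I).Nonempty := by
    obtain ⟨e, he, heC⟩ := Set.exists_of_ssubset
      (lt_of_le_of_ne (fun a ha => (htc.2.1 ha).1 : C ⊆ G.E) hne)
    obtain ⟨n, hnC, -, hn | ⟨-, a, ha, haI⟩ | ⟨hn, -⟩⟩ :=
      Execution.exists_blocked hwf.finE hcov he heC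
    · exact ⟨n, .inl hn⟩
    · exact ⟨a, .inl ⟨(hwf.rf_sub a n ha).1, haI⟩⟩
    · exact ⟨n, .inr ⟨Execution.Fsc_subset_F hn, hnC⟩⟩
  have hfin : (G.pending C I).Finite :=
    hwf.finE.subset fun e he => he.elim (fun h => h.1.1) (fun h => h.1.1)
  obtain ⟨m, hm, hmin⟩ := exists_tcl_minimal hcons.2.2.2.2.1 hfin hpend
  rcases hm with ⟨hmW, hmI⟩ | ⟨hmF, hmC⟩
  · exact hmI (hiss (Execution.issuable_of_no_pending hwf hsc hcov hmW hmin))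
  · obtain ⟨a, ha, ⟨-, hmW⟩ | ham⟩ :=
      Execution.exists_pending_of_uncovered hwf hsc hcov (.inr hmF) hmC
    · exact Execution.notMem_W_of_mem_F hmF hmW
    · exact hmin a ha ham
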